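/- arXiv:2305.16667 — 4 statements merged into one kernel-verified Lean document; each statement's English description precedes it below -/
import Mathlib

section
/- Let (T, μ, η) be a monad on a category 𝕏 with finite biproducts. If h° and h⋆ are both fusion invertors for (T, μ, η), then h°_A = h⋆_A for every object A; that is, a fusion invertor, if it exists, is unique. -/
/-!
Hopf monads on a category with finite biproducts (Bruguières–Lack–Virelizier style),
following "Hopf Monads on Biproducts".

Setting: `C` is a category with a zero object and binary biproducts (hence zero
morphisms), so that each hom-set carries the commutative monoid structure induced by
the biproducts.  `badd f g` is the induced addition of parallel maps.
-/

namespace HopfBiproducts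

open CategoryTheory CategoryTheory.Limits ZeroObject

universe v u

variable {C : Type u} [Category.{v} C] [HasZeroObject C] [HasZeroMorphisms C]
  [HasBinaryBiproducts C]

/-- The addition of parallel maps induced by binary biproducts:
`f + g = ⟨f, g⟩ ≫ [1, 1]`. -/
noncomputable def badd {X Y : C} (f g : X ⟶ Y) : X ⟶ Y :=
  biprod.lift f g ≫ biprod.desc (𝟙 Y) (𝟙 Y)

/-- The fusion operator `h_{A,B} = ι₁ ∘ T(π₁) + ι₂ ∘ μ_B ∘ T(π₂)` of a monad on a
category with finite biproducts. -/
noncomputable def fusion (T : Monad C) (A B : C) :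
    T.obj (A ⊞ T.obj B) ⟶ T.obj A ⊞ T.obj B :=
  badd (T.map biprod.fst ≫ biprod.inl) (T.map biprod.snd ≫ T.μ.app B ≫ biprod.inr)


/-- A *fusion invertor* for a monad `(T, μ, η)` on a category with finite biproducts:
a natural transformation `h°_A : T(A) ⟶ T(A ⊕ T(𝟘))` satisfying
[FI.1] `T(π₁) ∘ h°_A = 1`, [FI.2] `μ_𝟘 ∘ T(π₂) ∘ h°_A = 0`, and
[FI.3] `T(1_A ⊕ T(0)) ∘ h°_A ∘ T(π₁) + T(ι₂) ∘ η_{T(B)} ∘ μ_B ∘ T(π₂) = 1` for all `B`. -/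
structure FusionInvertor (T : Monad C) where
  /-- the component `h°_A : T(A) ⟶ T(A ⊕ T(𝟘))` -/
  app : ∀ A : C, T.obj A ⟶ T.obj (A ⊞ T.obj (0 : C))
  naturality : ∀ {A A' : C} (f : A ⟶ A'),
    T.map f ≫ app A' = app A ≫ T.map (biprod.map f (𝟙 (T.obj (0 : C))))
  fi1 : ∀ A : C, app A ≫ T.map biprod.fst = 𝟙 (T.obj A)
  fi2 : ∀ A : C, app A ≫ T.map biprod.snd ≫ T.μ.app (0 : C) = 0
  fi3 : ∀ A B : C,
    badd (T.map biprod.fst ≫ app A ≫ T.map (biprod.map (𝟙 A) (T.map (0 : (0 : C) ⟶ B))))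
        (T.map biprod.snd ≫ T.μ.app B ≫ T.η.app (T.obj B) ≫ T.map biprod.inr) =
      𝟙 (T.obj (A ⊞ T.obj B))

/-- Precomposition distributes over the addition induced by biproducts. -/
theorem comp_badd {W X Y : C} (k : W ⟶ X) (f g : X ⟶ Y) :
    k ≫ badd f g = badd (k ≫ f) (k ≫ g) := by
  have h : k ≫ biprod.lift f g = biprod.lift (k ≫ f) (k ≫ g) := by
    ext <;> simp
  rw [badd, badd, ← Category.assoc, h]

/-- The zero map is a right unit for the addition induced by biproducts. -/
theorem badd_zero {X Y : C} (f : X ⟶ Y) : badd f 0 = f := by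
  have h : biprod.lift f (0 : X ⟶ Y) = f ≫ biprod.inl := by
    ext <;> simp
  rw [badd, h, Category.assoc, biprod.inl_desc, Category.comp_id]

/-- a fusion invertor, if it exists, is unique. -/
theorem fusionInvertor_unique (T : Monad C) (h1 h2 : FusionInvertor T) (A : C) :
    h1.app A = h2.app A := by
  have key := congrArg (fun k => h1.app A ≫ k) (h2.fi3 A (0 : C))
  have hz : (0 : (0 : C) ⟶ 0) = 𝟙 (0 : C) := (isZero_zero C).eq_of_src _ _
  have hfst : h1.app A ≫ T.map biprod.fst ≫ h2.app A ≫
      T.map (biprod.map (𝟙 A) (T.map (0 : (0 : C) ⟶ 0))) = h2.app A := by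
    have hmap : biprod.map (𝟙 A) (T.map (0 : (0 : C) ⟶ 0)) = 𝟙 (A ⊞ T.obj (0 : C)) := by
      rw [hz, T.map_id]
      ext <;> simp
    rw [hmap, T.map_id, Category.comp_id, reassoc_of% (h1.fi1 A)]
  have hsnd : h1.app A ≫ T.map biprod.snd ≫ T.μ.app (0 : C) ≫
      T.η.app (T.obj (0 : C)) ≫ T.map (biprod.inr : _ ⟶ A ⊞ T.obj (0 : C)) = 0 := by
    rw [reassoc_of% (h1.fi2 A), zero_comp]
  simp only [comp_badd, Category.comp_id] at key
  rw [hfst, hsnd, badd_zero] at key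
  exact key.symm

end HopfBiproducts
end

section
/- Let (T, μ, η) be a Hopf monad on a category 𝕏 with finite biproducts, i.e. its fusion operator h_{A,B} is an isomorphism for all A, B with inverse h⁻¹_{A,B}. Then the natural transformation h°_A : T(A) → T(A ⊕ T(𝟘)) defined as the composite h°_A := h⁻¹_{A,𝟘} ∘ ι₁ is a fusion invertor for (T, μ, η). -/
/-!
Hopf monads on a category with finite biproducts (Bruguières–Lack–Virelizier style),
following "Hopf Monads on Biproducts".

Setting: `C` is a category with a zero object and binary biproducts (hence zero
morphisms), so that each hom-set carries the commutative monoid structure induced by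
the biproducts.  `badd f g` is the induced addition of parallel maps.
-/

namespace HopfBiproducts

open CategoryTheory CategoryTheory.Limits ZeroObject

universe v u

variable {C : Type u} [Category.{v} C] [HasZeroObject C] [HasZeroMorphisms C]
  [HasBinaryBiproducts C]

omit [HasZeroObject C] in
/-- Injecting two maps into the summands of a biproduct and adding gives their pairing. -/
theorem badd_comp_inl_comp_inr {X Y Z : C} (f : X ⟶ Y) (g : X ⟶ Z) :
    badd (f ≫ biprod.inl) (g ≫ biprod.inr) = biprod.lift f g := by
  have h₁ : biprod.lift (f ≫ biprod.inl) (g ≫ biprod.inr) =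
      biprod.lift f g ≫ biprod.map (biprod.inl : Y ⟶ Y ⊞ Z) (biprod.inr : Z ⟶ Y ⊞ Z) := by
    ext <;> simp
  have h₂ : biprod.map (biprod.inl : Y ⟶ Y ⊞ Z) (biprod.inr : Z ⟶ Y ⊞ Z) ≫
      biprod.desc (𝟙 _) (𝟙 _) = 𝟙 (Y ⊞ Z) := by
    apply biprod.hom_ext' <;> simp
  rw [badd, h₁, Category.assoc, h₂, Category.comp_id]

omit [HasZeroObject C] in
theorem badd_comp {X Y Z : C} (f g : X ⟶ Y) (k : Y ⟶ Z) :
    badd f g ≫ k = badd (f ≫ k) (g ≫ k) := by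
  have h₁ : biprod.lift (f ≫ k) (g ≫ k) = biprod.lift f g ≫ biprod.map k k := by
    ext <;> simp
  have h₂ : biprod.map k k ≫ biprod.desc (𝟙 Z) (𝟙 Z) = biprod.desc (𝟙 Y) (𝟙 Y) ≫ k := by
    apply biprod.hom_ext' <;> simp
  rw [badd, badd, h₁, Category.assoc, Category.assoc, h₂]

omit [HasZeroObject C] in
theorem fusion_eq_lift (T : Monad C) (A B : C) :
    fusion T A B = biprod.lift (T.map biprod.fst) (T.map biprod.snd ≫ T.μ.app B) := by
  rw [← badd_comp_inl_comp_inr, fusion, Category.assoc]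

omit [HasZeroObject C] in
theorem fusion_fst (T : Monad C) (A B : C) :
    fusion T A B ≫ biprod.fst = T.map biprod.fst := by
  rw [fusion_eq_lift, biprod.lift_fst]

omit [HasZeroObject C] in
theorem fusion_snd (T : Monad C) (A B : C) :
    fusion T A B ≫ biprod.snd = T.map biprod.snd ≫ T.μ.app B := by
  rw [fusion_eq_lift, biprod.lift_snd]

section

omit [HasZeroObject C]

variable (T : Monad C) [∀ A B : C, IsIso (fusion T A B)]

theorem inl_inv_fusion_map_fst (A B : C) :
    (biprod.inl ≫ inv (fusion T A B)) ≫ T.map biprod.fst = 𝟙 (T.obj A) := by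
  simp [← fusion_fst]

theorem inl_inv_fusion_map_snd_mu (A B : C) :
    (biprod.inl ≫ inv (fusion T A B)) ≫ T.map biprod.snd ≫ T.μ.app B = 0 := by
  simp [← fusion_snd]

/-- The maps `h⁻¹ ∘ ι₁` are compatible with a change of both arguments of the fusion operator. -/
theorem inl_inv_fusion_map_fusion {A A' B B' : C} (f : A ⟶ A') (g : B ⟶ B') :
    (biprod.inl ≫ inv (fusion T A B)) ≫ T.map (biprod.map f (T.map g)) ≫ fusion T A' B' =
      T.map f ≫ biprod.inl := by
  apply biprod.hom_ext
  · have h : T.map (biprod.map f (T.map g)) ≫ T.map biprod.fst = T.map biprod.fst ≫ T.map f := by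
      rw [← T.map_comp, biprod.map_fst, T.map_comp]
    rw [Category.assoc, Category.assoc _ (fusion T A' B'), fusion_fst, h, ← Category.assoc,
      inl_inv_fusion_map_fst, Category.assoc, biprod.inl_fst, Category.id_comp, Category.comp_id]
  · have h : T.map (biprod.map f (T.map g)) ≫ T.map biprod.snd ≫ T.μ.app B' =
        (T.map biprod.snd ≫ T.μ.app B) ≫ T.map g := by
      rw [← Category.assoc, ← T.map_comp, biprod.map_snd, T.map_comp, Category.assoc,
        Category.assoc]
      exact congrArg (T.map biprod.snd ≫ ·) (T.μ.naturality g)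
    rw [Category.assoc, Category.assoc _ (fusion T A' B'), fusion_snd, h, ← Category.assoc,
      inl_inv_fusion_map_snd_mu, zero_comp, Category.assoc, biprod.inl_snd, comp_zero]

end

omit [HasZeroObject C] in
theorem eta_map_inr_fusion (T : Monad C) (A B : C) :
    T.η.app (T.obj B) ≫ T.map biprod.inr ≫ fusion T A B = biprod.inr := by
  apply biprod.hom_ext
  · have h : T.η.app (T.obj B) ≫ T.map (0 : T.obj B ⟶ A) = 0 := by
      simpa using (T.η.naturality (0 : T.obj B ⟶ A)).symm
    rw [Category.assoc, Category.assoc, fusion_fst, ← T.map_comp, biprod.inr_fst, h]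
    exact biprod.inr_fst.symm
  · rw [Category.assoc, Category.assoc, fusion_snd, ← T.map_comp_assoc, biprod.inr_snd,
      T.map_id, Category.id_comp, T.left_unit]
    exact biprod.inr_snd.symm

/-- if `(T, μ, η)` is a Hopf monad (every fusion operator is invertible),
then `h°_A := h⁻¹_{A,𝟘} ∘ ι₁` is a fusion invertor for `(T, μ, η)`. -/
theorem fusionInvertor_of_isIso_fusion (T : Monad C) [∀ A B : C, IsIso (fusion T A B)] :
    ∃ hc : FusionInvertor T, ∀ A : C,
      hc.app A = biprod.inl ≫ inv (fusion T A (0 : C)) := by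
  refine ⟨{ app := fun A => biprod.inl ≫ inv (fusion T A (0 : C))
            naturality := fun {A A'} f => ?_
            fi1 := fun A => inl_inv_fusion_map_fst T A 0
            fi2 := fun A => inl_inv_fusion_map_snd_mu T A 0
            fi3 := fun A B => ?_ }, fun _ => rfl⟩
  · have h := inl_inv_fusion_map_fusion T f (𝟙 (0 : C))
    rw [T.map_id] at h
    rw [← cancel_mono (fusion T A' (0 : C)), Category.assoc (biprod.inl ≫ _), h]
    simp
  · rw [← cancel_mono (fusion T A B), badd_comp, Category.id_comp]
    have h := inl_inv_fusion_map_fusion T (𝟙 A) (0 : (0 : C) ⟶ B)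
    rw [T.map_id, Category.id_comp] at h
    simp only [Category.assoc] at h ⊢
    rw [h, eta_map_inr_fusion]
    rfl

end HopfBiproducts
end

section
/- Let 𝕏 be a category with finite biproducts whose hom commutative monoids have negatives (i.e. 𝕏 is preadditive/additive). Then for every object H of 𝕏, the monad T(−) := H ⊕ − with multiplication μ_A := ι₁ ∘ π₁ + ι₁ ∘ π₂ + ι₂ ∘ π₃ and unit η_A := ι₂ is a Hopf monad, i.e. its fusion operator h_{A,B} : H ⊕ A ⊕ H ⊕ B → H ⊕ A ⊕ H ⊕ B is an isomorphism for all A, B. -/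
/-!
Hopf monads on a preadditive category (category with negatives) with finite
biproducts, following "Hopf Monads on Biproducts".
-/

namespace HopfBiproductsNeg

open CategoryTheory CategoryTheory.Limits ZeroObject

universe v u

variable {C : Type u} [Category.{v} C] [Preadditive C] [HasZeroObject C]
  [HasBinaryBiproducts C]

/-- The fusion operator `h_{A,B} = ι₁ ∘ T(π₁) + ι₂ ∘ μ_B ∘ T(π₂)` of a monad on a
preadditive category with finite biproducts. -/
noncomputable def fusion (T : Monad C) (A B : C) :
    T.obj (A ⊞ T.obj B) ⟶ T.obj A ⊞ T.obj B :=
  T.map biprod.fst ≫ biprod.inl + T.map biprod.snd ≫ T.μ.app B ≫ biprod.inr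

/-- The multiplication `μ_A := ι₁ ∘ π₁ + ι₁ ∘ π₂ + ι₂ ∘ π₃ : H ⊕ H ⊕ A ⟶ H ⊕ A` of
the representable monad `H ⊕ −`. -/
noncomputable def muF (H A : C) : H ⊞ (H ⊞ A) ⟶ H ⊞ A :=
  biprod.fst ≫ biprod.inl + (biprod.snd ≫ biprod.fst) ≫ biprod.inl +
    (biprod.snd ≫ biprod.snd) ≫ biprod.inr

theorem muF_eq (H A : C) : muF H A = biprod.desc biprod.inl (𝟙 (H ⊞ A)) := by
  apply biprod.hom_ext' <;> simp [muF, biprod.total]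

/-- The representable monad `T(−) := H ⊕ −` on a preadditive category with finite
biproducts, with unit `η_A := ι₂` and multiplication
`μ_A := ι₁ ∘ π₁ + ι₁ ∘ π₂ + ι₂ ∘ π₃`. -/
noncomputable def biprodMonad (H : C) : Monad C where
  obj A := H ⊞ A
  map f := biprod.map (𝟙 H) f
  map_id A := by apply biprod.hom_ext <;> simp
  map_comp f g := by apply biprod.hom_ext <;> simp
  η :=
    { app := fun A => (biprod.inr : A ⟶ H ⊞ A)
      naturality := fun A B f => by dsimp; simp }
  μ :=
    { app := fun A => muF H A
      naturality := fun A B f => by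
        dsimp
        rw [muF_eq, muF_eq]
        apply biprod.hom_ext' <;> simp }
  assoc X := by
    dsimp
    rw [muF_eq, muF_eq]
    apply biprod.hom_ext' <;> simp
  left_unit X := by
    dsimp
    rw [muF_eq]
    simp
  right_unit X := by
    dsimp
    rw [muF_eq]
    apply biprod.hom_ext' <;> simp

/-- The shear isomorphism `(x, a, y, b) ↦ ((x, a), (x + y, b))`, with inverse
`((x, a), (y, b)) ↦ (x, a, y - x, b)`. -/
@[simps]
noncomputable def shearIso (H A B : C) : H ⊞ (A ⊞ (H ⊞ B)) ≅ (H ⊞ A) ⊞ (H ⊞ B) where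
  hom := biprod.lift
    (biprod.lift biprod.fst (biprod.snd ≫ biprod.fst))
    (biprod.lift (biprod.fst + biprod.snd ≫ biprod.snd ≫ biprod.fst)
      (biprod.snd ≫ biprod.snd ≫ biprod.snd))
  inv := biprod.lift (biprod.fst ≫ biprod.fst)
    (biprod.lift (biprod.fst ≫ biprod.snd)
      (biprod.lift (biprod.snd ≫ biprod.fst - biprod.fst ≫ biprod.fst)
        (biprod.snd ≫ biprod.snd)))
  hom_inv_id := by
    refine biprod.hom_ext _ _ ?_ (biprod.hom_ext _ _ ?_ (biprod.hom_ext _ _ ?_ ?_)) <;> simp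
  inv_hom_id := by
    apply biprod.hom_ext <;> apply biprod.hom_ext <;> simp

theorem map_fst_add_map_snd_muF (H A B : C) :
    (biprod.map (𝟙 H) biprod.fst : H ⊞ (A ⊞ (H ⊞ B)) ⟶ H ⊞ A) ≫ biprod.inl +
      biprod.map (𝟙 H) biprod.snd ≫ muF H B ≫ biprod.inr = (shearIso H A B).hom := by
  apply biprod.hom_ext <;> apply biprod.hom_ext <;> simp [muF]

theorem fusion_biprodMonad (H A B : C) :
    fusion (biprodMonad H) A B = (shearIso H A B).hom :=
  map_fst_add_map_snd_muF H A B

/-- in a preadditive category with finite biproducts, for every object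
`H` the representable monad `H ⊕ −` is a Hopf monad: all its fusion operators are
isomorphisms. -/
theorem biprodMonad_isHopf (H : C) :
    ∀ A B : C, IsIso (fusion (biprodMonad H) A B) := by
  intro A B
  rw [fusion_biprodMonad]
  exact (shearIso H A B).isIso_hom

end HopfBiproductsNeg
end

section
/- Let (T, μ, η) be a Hopf monad on a preadditive category 𝕏 with finite biproducts. Then the fusion invertor h°_A : T(A) → T(A ⊕ T(𝟘)) is given by h°_A = T(ι₁) − T(ι₂) ∘ η_{T(𝟘)} ∘ T(0), where 0 : A → 𝟘 is the zero map. -/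
/-!
Hopf monads on a preadditive category (category with negatives) with finite
biproducts, following "Hopf Monads on Biproducts".
-/

namespace HopfBiproductsNeg

open CategoryTheory CategoryTheory.Limits ZeroObject

universe v u

variable {C : Type u} [Category.{v} C] [Preadditive C] [HasZeroObject C]
  [HasBinaryBiproducts C]

/-- A *fusion invertor* for a monad `(T, μ, η)`: a natural transformation
`h°_A : T(A) ⟶ T(A ⊕ T(𝟘))` satisfying [FI.1] `T(π₁) ∘ h°_A = 1`,
[FI.2] `μ_𝟘 ∘ T(π₂) ∘ h°_A = 0`, and
[FI.3] `T(1_A ⊕ T(0)) ∘ h°_A ∘ T(π₁) + T(ι₂) ∘ η_{T(B)} ∘ μ_B ∘ T(π₂) = 1` for all `B`. -/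
structure FusionInvertor (T : Monad C) where
  /-- the component `h°_A : T(A) ⟶ T(A ⊕ T(𝟘))` -/
  app : ∀ A : C, T.obj A ⟶ T.obj (A ⊞ T.obj (0 : C))
  naturality : ∀ {A A' : C} (f : A ⟶ A'),
    T.map f ≫ app A' = app A ≫ T.map (biprod.map f (𝟙 (T.obj (0 : C))))
  fi1 : ∀ A : C, app A ≫ T.map biprod.fst = 𝟙 (T.obj A)
  fi2 : ∀ A : C, app A ≫ T.map biprod.snd ≫ T.μ.app (0 : C) = 0
  fi3 : ∀ A B : C,
    T.map biprod.fst ≫ app A ≫ T.map (biprod.map (𝟙 A) (T.map (0 : (0 : C) ⟶ B))) +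
        T.map biprod.snd ≫ T.μ.app B ≫ T.η.app (T.obj B) ≫ T.map biprod.inr =
      𝟙 (T.obj (A ⊞ T.obj B))

omit [HasZeroObject C] in
/-- For a Hopf monad, maps into `T(A ⊕ T(B))` are determined by their composites with `T(π₁)`
and `μ_B ∘ T(π₂)`. -/
theorem fusion_hom_ext (T : Monad C) {A B X : C} [IsIso (fusion T A B)]
    {f g : X ⟶ T.obj (A ⊞ T.obj B)}
    (h₁ : f ≫ T.map biprod.fst = g ≫ T.map biprod.fst)
    (h₂ : f ≫ T.map biprod.snd ≫ T.μ.app B = g ≫ T.map biprod.snd ≫ T.μ.app B) :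
    f = g := by
  rw [← cancel_mono (fusion T A B)]
  simp only [fusion, Preadditive.comp_add]
  rw [reassoc_of% h₁, reassoc_of% h₂]

omit [HasZeroObject C] in
/-- Inserting the second summand through the unit and projecting to the first is zero. -/
theorem unit_map_inr_map_fst (T : Monad C) (A X : C) :
    T.η.app X ≫ T.map (biprod.inr : X ⟶ A ⊞ X) ≫ T.map biprod.fst = 0 := by
  rw [← T.map_comp, biprod.inr_fst, ← T.η.naturality]
  simp

omit [HasZeroObject C] in
/-- Inserting the second summand through the unit and projecting back to it is the unit. -/
theorem unit_map_inr_map_snd (T : Monad C) (A X : C) :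
    T.η.app X ≫ T.map (biprod.inr : X ⟶ A ⊞ X) ≫ T.map biprod.snd = T.η.app X := by
  rw [← T.map_comp, biprod.inr_snd, T.map_id, Category.comp_id]

omit [HasZeroObject C] [HasBinaryBiproducts C] in
/-- Since zero maps factor through the unit, `μ_B ∘ T(0) = T(0)`. -/
theorem map_zero_mu (T : Monad C) (A B : C) :
    T.map (0 : A ⟶ T.obj B) ≫ T.μ.app B = T.map (0 : A ⟶ B) := by
  have h : (0 : A ⟶ T.obj B) = (0 : A ⟶ B) ≫ T.η.app B := by simp
  rw [h, T.map_comp, Category.assoc, T.right_unit]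
  exact Category.comp_id _

omit [Preadditive C] [HasZeroObject C] [HasBinaryBiproducts C] in
/-- Naturality of the unit at the map `T(f)`. -/
theorem unit_map_map (T : Monad C) {X Y : C} (f : X ⟶ Y) :
    T.η.app (T.obj X) ≫ T.map (T.map f) = T.map f ≫ T.η.app (T.obj Y) :=
  (T.η.naturality (T.map f)).symm

/-- The fusion invertor `T(ι₁) − T(ι₂) ∘ η_{T(𝟘)} ∘ T(0)` of a Hopf monad. -/
noncomputable def fusionInvertorOfNeg (T : Monad C) [∀ A B : C, IsIso (fusion T A B)] :
    FusionInvertor T where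
  app A := T.map (biprod.inl : A ⟶ A ⊞ T.obj (0 : C)) -
    T.map (0 : A ⟶ (0 : C)) ≫ T.η.app (T.obj (0 : C)) ≫ T.map biprod.inr
  naturality f := by
    simp only [Preadditive.comp_sub, Preadditive.sub_comp, Category.assoc, ← T.map_comp,
      ← T.map_comp_assoc, biprod.inl_map, biprod.inr_map, comp_zero, Category.id_comp]
  fi1 A := by
    rw [Preadditive.sub_comp, Category.assoc, Category.assoc, unit_map_inr_map_fst,
      ← T.map_comp, biprod.inl_fst, T.map_id, comp_zero, sub_zero]
  fi2 A := by
    rw [Preadditive.sub_comp, ← T.map_comp_assoc, biprod.inl_snd, map_zero_mu, Category.assoc,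
      Category.assoc, reassoc_of% unit_map_inr_map_snd T A (T.obj (0 : C)), T.left_unit]
    simp
  fi3 A B := by
    have key : (T.map (biprod.inl : A ⟶ A ⊞ T.obj (0 : C)) -
        T.map (0 : A ⟶ (0 : C)) ≫ T.η.app (T.obj (0 : C)) ≫ T.map biprod.inr) ≫
        T.map (biprod.map (𝟙 A) (T.map (0 : (0 : C) ⟶ B))) =
        T.map biprod.inl - T.map (0 : A ⟶ B) ≫ T.η.app (T.obj B) ≫ T.map biprod.inr := by
      rw [Preadditive.sub_comp, Category.assoc, Category.assoc, ← T.map_comp, ← T.map_comp,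
        biprod.inl_map, biprod.inr_map, Category.id_comp, T.map_comp,
        reassoc_of% unit_map_map T (0 : (0 : C) ⟶ B), ← T.map_comp_assoc, comp_zero]
    rw [key]
    apply fusion_hom_ext
    · simp only [Preadditive.add_comp, Preadditive.sub_comp, Preadditive.comp_sub, Category.assoc,
        unit_map_inr_map_fst, comp_zero, sub_zero, add_zero, Category.id_comp]
      rw [← T.map_comp biprod.inl, biprod.inl_fst, T.map_id, Category.comp_id]
    · simp only [Preadditive.add_comp, Preadditive.sub_comp, Preadditive.comp_sub, Category.assoc,
        reassoc_of% unit_map_inr_map_snd T A (T.obj B), T.left_unit, Category.id_comp]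
      rw [← T.map_comp_assoc biprod.inl, biprod.inl_snd, map_zero_mu]
      erw [Category.comp_id, Category.comp_id]
      rw [sub_self, zero_add]

/-- for a Hopf monad on a preadditive category with finite biproducts,
the fusion invertor is given by `h°_A = T(ι₁) − T(ι₂) ∘ η_{T(𝟘)} ∘ T(0)`. -/
theorem fusionInvertor_eq_of_neg (T : Monad C) [∀ A B : C, IsIso (fusion T A B)] :
    ∃ hc : FusionInvertor T, ∀ A : C,
      hc.app A =
        T.map (biprod.inl : A ⟶ A ⊞ T.obj (0 : C)) -
          T.map (0 : A ⟶ (0 : C)) ≫ T.η.app (T.obj (0 : C)) ≫ T.map biprod.inr :=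
  ⟨fusionInvertorOfNeg T, fun _ => rfl⟩

end HopfBiproductsNeg
end
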